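/- Let n ≥ 4 be even and 1 < k < n−1 with k ≡ 3 (mod 4). Then OT_{n,k} = ⟨τ, φ⟩ equals the parity subgroup PS_n, the set of permutations of {1,...,n} that either preserve the parity of every element or reverse the parity of every element. -/

import Mathlib

/-- The flip of the oval track puzzle: reverses the block of the first `k`
positions (0-indexed `0,…,k-1`, i.e. tiles `1,…,k`) and fixes the rest. -/
def otFlip (n k : ℕ) : Equiv.Perm (Fin n) :=
  Function.Involutive.toPerm
    (fun i => if h : i.val < k ∧ k ≤ n then ⟨k - 1 - i.val, by omega⟩ else i)
    (by
      intro i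
      dsimp only
      by_cases h1 : i.val < k ∧ k ≤ n
      · rw [dif_pos h1]
        rw [dif_pos (show (⟨k - 1 - i.val, by omega⟩ : Fin n).val < k ∧ k ≤ n from
          ⟨by simp; omega, h1.2⟩)]
        exact Fin.ext (by simp; omega)
      · rw [dif_neg h1, dif_neg h1])

/-- The cycle on `Fin n` given (0-indexed) by a list of natural numbers. -/
def otCycle (n : ℕ) (l : List ℕ) : Equiv.Perm (Fin n) :=
  (l.filterMap (fun a => if h : a < n then some ⟨a, h⟩ else none)).formPerm

/-- Type I: preserves the parity of every tile label. -/
def TypeI (n : ℕ) (σ : Equiv.Perm (Fin n)) : Prop :=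
  ∀ i : Fin n, (σ i).val % 2 = i.val % 2

/-- Type II: reverses the parity of every tile label. -/
def TypeII (n : ℕ) (σ : Equiv.Perm (Fin n)) : Prop :=
  ∀ i : Fin n, (σ i).val % 2 ≠ i.val % 2

open Equiv

lemma val_otFlip (n k : ℕ) (hk : k ≤ n) (i : Fin n) :
    (otFlip n k i).val = if i.val < k then k - 1 - i.val else i.val := by
  by_cases h : i.val < k
  · simp [otFlip, h, hk]
  · rw [if_neg h]
    exact congrArg Fin.val (dif_neg fun h' => h h'.1)

lemma val_finRotate (n : ℕ) (i : Fin n) :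
    (finRotate n i).val = if i.val + 1 = n then 0 else i.val + 1 := by
  cases n with
  | zero => exact i.elim0
  | succ m =>
    rw [coe_finRotate]
    simp [Fin.ext_iff, Fin.val_last]

/-- The cycle `(a a+1 ... b)` on `Fin n`; the identity unless `a ≤ b < n`. -/
def intervalCycle (n a b : ℕ) : Perm (Fin n) where
  toFun i := if h : b < n ∧ a ≤ i.val ∧ i.val ≤ b then
    (if h' : i.val = b then ⟨a, by omega⟩ else ⟨i.val + 1, by omega⟩) else i
  invFun i := if h : b < n ∧ a ≤ i.val ∧ i.val ≤ b then
    (if h' : i.val = a then ⟨b, by omega⟩ else ⟨i.val - 1, by omega⟩) else i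
  left_inv i := by grind
  right_inv i := by grind

lemma val_intervalCycle {n a b : ℕ} (hb : b < n) (i : Fin n) :
    (intervalCycle n a b i).val =
      if a ≤ i.val ∧ i.val ≤ b then (if i.val = b then a else i.val + 1) else i.val := by
  simp only [intervalCycle, Equiv.coe_fn_mk]
  grind

lemma otFlip_mul_otFlip {n l : ℕ} (hl : l < n) :
    otFlip n (l + 1) * otFlip n l = intervalCycle n 0 l := by
  ext i
  simp only [Perm.mul_apply, val_intervalCycle hl, val_otFlip n (l + 1) hl, val_otFlip n l hl.le]
  grind

lemma finRotate_mul_otFlip_mul_inv_mul_otFlip {n l : ℕ} (hl : l + 1 < n) :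
    finRotate n * otFlip n l * (finRotate n)⁻¹ * otFlip n (l + 1) = intervalCycle n 0 l := by
  have h : finRotate n * otFlip n l =
      intervalCycle n 0 l * otFlip n (l + 1) * finRotate n := by
    ext i
    simp only [Perm.mul_apply, val_intervalCycle (show l < n by omega),
      val_otFlip n (l + 1) (by omega), val_otFlip n l (by omega), val_finRotate]
    grind
  have h2 : otFlip n (l + 1) * otFlip n (l + 1) = 1 := by
    ext i
    simp only [Perm.mul_apply, val_otFlip n (l + 1) (by omega), Perm.one_apply]
    grind
  rw [h, mul_inv_cancel_right, mul_assoc, h2, mul_one]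

lemma finRotate_conj_intervalCycle {n a b : ℕ} (hb : b + 1 < n) :
    finRotate n * intervalCycle n a b * (finRotate n)⁻¹ = intervalCycle n (a + 1) (b + 1) := by
  rw [mul_inv_eq_iff_eq_mul]
  ext i
  simp only [Perm.mul_apply, val_intervalCycle (show b < n by omega), val_intervalCycle hb,
    val_finRotate]
  grind

lemma intervalCycle_relation {n l : ℕ} (hl0 : 0 < l) (hl : l + 1 < n) :
    intervalCycle n 1 (l + 1) * intervalCycle n 0 l * intervalCycle n (l - 1) (l + 1) =
      intervalCycle n 0 l * intervalCycle n 0 l := by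
  ext i
  simp only [Perm.mul_apply, val_intervalCycle (show l < n by omega), val_intervalCycle hl]
  grind

lemma intervalCycle_mul_intervalCycle {n a b c : ℕ} (hab : a ≤ b) (hbc : b ≤ c) (hc : c < n) :
    intervalCycle n a b * intervalCycle n b c = intervalCycle n a c := by
  ext i
  simp only [Perm.mul_apply, val_intervalCycle (show b < n by omega), val_intervalCycle hc]
  grind

/-- A subgroup of `Perm (Fin n)` normalized by the full rotation that contains the cycle
`(0 1 ... 2m+1)` contains `(0 1)`. -/
lemma intervalCycle_zero_one_mem {n m : ℕ} (hm : 2 * m + 2 < n) (H : Subgroup (Perm (Fin n)))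
    (hH : ∀ h, finRotate n * h * (finRotate n)⁻¹ ∈ H ↔ h ∈ H)
    (hc : intervalCycle n 0 (2 * m + 1) ∈ H) : intervalCycle n 0 1 ∈ H := by
  have hshift (a b : ℕ) (hb : b + 1 < n) :
      intervalCycle n (a + 1) (b + 1) ∈ H ↔ intervalCycle n a b ∈ H := by
    rw [← finRotate_conj_intervalCycle hb, hH]
  have htop : intervalCycle n (2 * m) (2 * m + 2) ∈ H := by
    have h := intervalCycle_relation (n := n) (l := 2 * m + 1) (by omega) (by omega)
    rw [← H.mul_mem_cancel_left (H.mul_mem ((hshift 0 _ (by omega)).2 hc) hc)]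
    exact h ▸ H.mul_mem hc hc
  have hthree (j : ℕ) : ∀ i, i + j = 2 * m → intervalCycle n i (i + 2) ∈ H := by
    induction j with
    | zero => rintro i rfl; exact htop
    | succ j ih =>
      intro i hi
      rw [← hshift _ _ (by omega)]
      exact ih (i + 1) (by omega)
  have hdown (j : ℕ) : ∀ i, i + j = m → intervalCycle n 0 (2 * i + 1) ∈ H := by
    induction j with
    | zero => rintro i rfl; exact hc
    | succ j ih =>
      intro i hi
      have h1 := hthree (2 * m - (2 * i + 1)) (2 * i + 1) (by omega)
      rw [← H.mul_mem_cancel_right h1,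
        intervalCycle_mul_intervalCycle (by omega) (by omega) (by omega)]
      exact ih (i + 1) (by omega)
  exact hdown m 0 (by omega)

lemma intervalCycle_zero_one_eq_swap {n : ℕ} (hn : 1 < n) :
    intervalCycle n 0 1 = swap ⟨0, by omega⟩ ⟨1, hn⟩ := by
  ext i
  rw [val_intervalCycle hn, swap_apply_def]
  grind

lemma eq_top_of_finRotate_mem {n m : ℕ} (hm : 2 * m + 2 < n) (H : Subgroup (Perm (Fin n)))
    (hs : finRotate n ∈ H) (hc : intervalCycle n 0 (2 * m + 1) ∈ H) : H = ⊤ := by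
  have h01 := intervalCycle_zero_one_mem hm H (fun h => by
    rw [H.mul_mem_cancel_right (H.inv_mem hs), H.mul_mem_cancel_left hs]) hc
  rw [intervalCycle_zero_one_eq_swap (by omega)] at h01
  obtain ⟨n, rfl⟩ : ∃ k, n = k + 2 := ⟨n - 2, by omega⟩
  rw [eq_top_iff, ← Perm.closure_cycle_adjacent_swap (isCycle_finRotate (n := n))
    support_finRotate ⟨0, by omega⟩, Subgroup.closure_le]
  rintro x (rfl | rfl)
  · exact hs
  · have h : finRotate (n + 2) ⟨0, by omega⟩ = ⟨1, by omega⟩ := by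
      ext
      simp
    rw [h]
    exact h01

lemma eq_top_of_normal {n m : ℕ} (hm : 2 * m + 2 < n) (H : Subgroup (Perm (Fin n)))
    [hH : H.Normal] (hc : intervalCycle n 0 (2 * m + 1) ∈ H) : H = ⊤ := by
  have h01 := intervalCycle_zero_one_mem hm H (fun h => by
    rw [hH.mem_comm_iff, inv_mul_cancel_left]) hc
  rw [intervalCycle_zero_one_eq_swap (by omega)] at h01
  rw [eq_top_iff, ← Perm.closure_isSwap, Subgroup.closure_le]
  rintro x ⟨a, b, hab, rfl⟩
  obtain ⟨g, hg⟩ := isConj_iff.1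
    (Perm.isConj_swap (show (⟨0, by omega⟩ : Fin n) ≠ ⟨1, by omega⟩ by simp) hab)
  exact hg ▸ hH.conj_mem _ h01 g

/-- Splits `Fin (2 * n)` into its even and its odd elements. -/
def parityEquiv (n : ℕ) : Fin n ⊕ Fin n ≃ Fin (2 * n) where
  toFun := Sum.elim (fun i => ⟨2 * i.val, by omega⟩) (fun i => ⟨2 * i.val + 1, by omega⟩)
  invFun i := if i.val % 2 = 0 then .inl ⟨i.val / 2, by omega⟩ else .inr ⟨i.val / 2, by omega⟩
  left_inv i := by
    rcases i with i | i
    · simp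
    · simp [Nat.add_mod, Fin.ext_iff]
      omega
  right_inv i := by
    by_cases h : i.val % 2 = 0
    · simp [h, Fin.ext_iff]
      omega
    · simp [h, Fin.ext_iff]
      omega

@[simp] lemma val_parityEquiv_inl (n : ℕ) (i : Fin n) :
    (parityEquiv n (.inl i)).val = 2 * i.val := rfl

@[simp] lemma val_parityEquiv_inr (n : ℕ) (i : Fin n) :
    (parityEquiv n (.inr i)).val = 2 * i.val + 1 := rfl

/-- A permutation of the even positions and one of the odd positions, combined. -/
def parityHom (n : ℕ) : Perm (Fin n) × Perm (Fin n) →* Perm (Fin (2 * n)) :=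
  (parityEquiv n).permCongrHom.toMonoidHom.comp (Perm.sumCongrHom (Fin n) (Fin n))

@[simp] lemma parityHom_inl {n : ℕ} (p : Perm (Fin n) × Perm (Fin n)) (i : Fin n) :
    parityHom n p (parityEquiv n (.inl i)) = parityEquiv n (.inl (p.1 i)) := by
  simp [parityHom, Equiv.permCongrHom]

@[simp] lemma parityHom_inr {n : ℕ} (p : Perm (Fin n) × Perm (Fin n)) (i : Fin n) :
    parityHom n p (parityEquiv n (.inr i)) = parityEquiv n (.inr (p.2 i)) := by
  simp [parityHom, Equiv.permCongrHom]

lemma parityEquiv_perm_ext {n : ℕ} {f g : Perm (Fin (2 * n))}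
    (hl : ∀ i, f (parityEquiv n (.inl i)) = g (parityEquiv n (.inl i)))
    (hr : ∀ i, f (parityEquiv n (.inr i)) = g (parityEquiv n (.inr i))) : f = g := by
  refine Equiv.ext fun x => ?_
  obtain ⟨i | i, rfl⟩ := (parityEquiv n).surjective x
  exacts [hl i, hr i]

lemma finRotate_parityEquiv_inl {n : ℕ} (i : Fin n) :
    finRotate (2 * n) (parityEquiv n (.inl i)) = parityEquiv n (.inr i) := by
  ext
  simp only [val_finRotate, val_parityEquiv_inl, val_parityEquiv_inr]
  grind

lemma finRotate_parityEquiv_inr {n : ℕ} (i : Fin n) :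
    finRotate (2 * n) (parityEquiv n (.inr i)) = parityEquiv n (.inl (finRotate n i)) := by
  ext
  simp only [val_finRotate, val_parityEquiv_inl, val_parityEquiv_inr]
  grind

lemma finRotate_mul_self_eq_parityHom (n : ℕ) :
    finRotate (2 * n) * finRotate (2 * n) = parityHom n (finRotate n, finRotate n) :=
  parityEquiv_perm_ext
    (fun i => by simp only [Perm.mul_apply, finRotate_parityEquiv_inl,
      finRotate_parityEquiv_inr, parityHom_inl])
    (fun i => by simp only [Perm.mul_apply, finRotate_parityEquiv_inl,
      finRotate_parityEquiv_inr, parityHom_inr])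

lemma finRotate_conj_parityHom {n : ℕ} (a b : Perm (Fin n)) :
    finRotate (2 * n) * parityHom n (a, b) * (finRotate (2 * n))⁻¹ =
      parityHom n (finRotate n * b * (finRotate n)⁻¹, a) := by
  rw [mul_inv_eq_iff_eq_mul]
  exact parityEquiv_perm_ext
    (fun i => by simp only [Perm.mul_apply, finRotate_parityEquiv_inl, parityHom_inl, parityHom_inr])
    (fun i => by simp only [Perm.mul_apply, finRotate_parityEquiv_inr, parityHom_inl, parityHom_inr,
      Perm.inv_def, Equiv.symm_apply_apply])

lemma otFlip_eq_parityHom {n l : ℕ} (hl : l < n) :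
    otFlip (2 * n) (2 * l + 1) = parityHom n (otFlip n (l + 1), otFlip n l) := by
  refine parityEquiv_perm_ext (fun i => ?_) (fun i => ?_)
  · ext
    simp only [parityHom_inl, val_parityEquiv_inl, val_otFlip (2 * n) (2 * l + 1) (by omega),
      val_otFlip n (l + 1) hl]
    grind
  · ext
    simp only [parityHom_inr, val_parityEquiv_inr, val_otFlip (2 * n) (2 * l + 1) (by omega),
      val_otFlip n l hl.le]
    grind

lemma TypeI.exists_parityHom {n : ℕ} {σ : Perm (Fin (2 * n))} (hσ : TypeI (2 * n) σ) :
    ∃ p, parityHom n p = σ := by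
  have hmaps : Set.MapsTo ((parityEquiv n).symm.permCongr σ)
      (Set.range Sum.inl) (Set.range Sum.inl) := by
    rintro _ ⟨i, rfl⟩
    obtain ⟨j | j, hj⟩ := (parityEquiv n).surjective (σ (parityEquiv n (.inl i)))
    · exact ⟨j, by simp [← hj]⟩
    · have h := hσ (parityEquiv n (.inl i))
      simp only [← hj, val_parityEquiv_inl, val_parityEquiv_inr] at h
      omega
  obtain ⟨p, hp⟩ := Perm.mem_sumCongrHom_range_of_perm_mapsTo_inl hmaps
  refine ⟨p, ?_⟩
  simp only [parityHom, MonoidHom.comp_apply, hp]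
  ext
  simp [Equiv.permCongrHom]

/-- If a group contains the rotation and the flip, it contains all parity-preserving
permutations. -/
lemma parityHom_mem {n m : ℕ} (hm : 2 * m + 2 < n) (G : Subgroup (Perm (Fin (2 * n))))
    (hτ : finRotate (2 * n) ∈ G) (hφ : otFlip (2 * n) (2 * (2 * m + 1) + 1) ∈ G)
    (p : Perm (Fin n) × Perm (Fin n)) : parityHom n p ∈ G := by
  rw [otFlip_eq_parityHom (by omega)] at hφ
  have hconj {a b : Perm (Fin n)} (h : parityHom n (a, b) ∈ G) :
      parityHom n (finRotate n * b * (finRotate n)⁻¹, a) ∈ G := by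
    rw [← finRotate_conj_parityHom]
    exact G.mul_mem (G.mul_mem hτ h) (G.inv_mem hτ)
  let D : Subgroup (Perm (Fin n)) :=
    G.comap ((parityHom n).comp ((MonoidHom.id _).prod (MonoidHom.id _)))
  have hD : D = ⊤ := by
    refine eq_top_of_finRotate_mem hm D ?_ ?_
    · change parityHom n (finRotate n, finRotate n) ∈ G
      rw [← finRotate_mul_self_eq_parityHom]
      exact G.mul_mem hτ hτ
    · change parityHom n (intervalCycle n 0 (2 * m + 1), intervalCycle n 0 (2 * m + 1)) ∈ G
      have h := G.mul_mem (hconj hφ) hφ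
      rwa [← map_mul, Prod.mk_mul_mk, finRotate_mul_otFlip_mul_inv_mul_otFlip (by omega),
        otFlip_mul_otFlip (by omega)] at h
  have hdiag (a : Perm (Fin n)) : parityHom n (a, a) ∈ G := by
    have : a ∈ D := hD ▸ Subgroup.mem_top a
    exact this
  let P : Subgroup (Perm (Fin n)) := G.comap ((parityHom n).comp (MonoidHom.inl _ _))
  have hPn : P.Normal := ⟨fun a ha g => by
    change parityHom n (g * a * g⁻¹, 1) ∈ G
    have h := G.mul_mem (G.mul_mem (hdiag g) (show parityHom n (a, 1) ∈ G from ha)) (hdiag g⁻¹)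
    simpa only [← map_mul, Prod.mk_mul_mk, mul_one, mul_inv_cancel] using h⟩
  have hP : P = ⊤ := by
    refine eq_top_of_normal hm P ?_
    change parityHom n (intervalCycle n 0 (2 * m + 1), 1) ∈ G
    have h := G.mul_mem hφ (hdiag (otFlip n (2 * m + 1)))
    have h2 : otFlip n (2 * m + 1) * otFlip n (2 * m + 1) = 1 := by
      ext i
      simp only [Perm.mul_apply, val_otFlip n (2 * m + 1) (by omega), Perm.one_apply]
      grind
    rwa [← map_mul, Prod.mk_mul_mk, otFlip_mul_otFlip (by omega), h2] at h
  have hleft (a : Perm (Fin n)) : parityHom n (a, 1) ∈ G := by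
    have : a ∈ P := hP ▸ Subgroup.mem_top a
    exact this
  have hright (a : Perm (Fin n)) : parityHom n (1, a) ∈ G := by
    simpa using hconj (hleft a)
  obtain ⟨a, b⟩ := p
  simpa [← map_mul] using G.mul_mem (hleft a) (hright b)

/-- The parity subgroup: the permutations preserving or reversing the parity of every element. -/
def paritySubgroup (n : ℕ) : Subgroup (Perm (Fin n)) where
  carrier := {σ | TypeI n σ ∨ TypeII n σ}
  one_mem' := Or.inl fun _ => rfl
  mul_mem' {a b} ha hb := by
    rcases ha with ha | ha <;> rcases hb with hb | hb
    · exact Or.inl fun i => (ha _).trans (hb i)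
    · exact Or.inr fun i h => hb i ((ha _).symm.trans h)
    · exact Or.inr fun i h => ha _ (h.trans (hb i).symm)
    · refine Or.inl fun i => ?_
      have h1 := ha (b i)
      have h2 := hb i
      rw [Perm.mul_apply]
      omega
  inv_mem' {a} ha := by
    rcases ha with ha | ha
    · exact Or.inl fun i => by simpa using (ha (a⁻¹ i)).symm
    · exact Or.inr fun i => by simpa using (ha (a⁻¹ i)).symm

lemma typeII_finRotate (n : ℕ) : TypeII (2 * n) (finRotate (2 * n)) := fun i => by
  rw [val_finRotate]
  grind

theorem stmt19 (n k : ℕ) (hn : 4 ≤ n) (hne : Even n) (hk1 : 1 < k)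
    (hk2 : k < n - 1) (hk4 : k % 4 = 3) :
    ((Subgroup.closure {finRotate n, otFlip n k} : Subgroup (Equiv.Perm (Fin n))) :
        Set (Equiv.Perm (Fin n))) =
      {σ | TypeI n σ ∨ TypeII n σ} := by
  obtain ⟨N, rfl⟩ := hne.two_dvd
  obtain ⟨m, rfl⟩ : ∃ m, k = 2 * (2 * m + 1) + 1 := ⟨k / 4, by omega⟩
  change _ = (paritySubgroup (2 * N) : Set (Perm (Fin (2 * N))))
  rw [SetLike.coe_set_eq]
  refine le_antisymm ((Subgroup.closure_le _).2 ?_) fun σ hσ => ?_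
  · rintro x (rfl | rfl)
    · exact Or.inr (typeII_finRotate N)
    · refine Or.inl fun i => ?_
      rw [val_otFlip _ _ (by omega)]
      grind
  · set G := Subgroup.closure {finRotate (2 * N), otFlip (2 * N) (2 * (2 * m + 1) + 1)}
    have hτ : finRotate (2 * N) ∈ G := Subgroup.subset_closure (by simp)
    have hφ : otFlip (2 * N) (2 * (2 * m + 1) + 1) ∈ G := Subgroup.subset_closure (by simp)
    have hI (ρ : Perm (Fin (2 * N))) (hρ : TypeI (2 * N) ρ) : ρ ∈ G := by
      obtain ⟨p, rfl⟩ := hρ.exists_parityHom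
      exact parityHom_mem (by omega) G hτ hφ p
    rcases hσ with hσ | hσ
    · exact hI σ hσ
    · rw [← G.mul_mem_cancel_left hτ]
      refine hI _ fun i => ?_
      have h1 := typeII_finRotate N (σ i)
      have h2 := hσ i
      rw [Perm.mul_apply]
      omega
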